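/- Let G be a connected comparability graph with a transitive orientation E⃗, let v0 be a sink of this orientation, and let L_0, L_1, ..., L_z be the distance layers of G from v0. Then for every 0 ≤ i < z, every oriented edge between a vertex of L_i and a vertex of L_{i+1} is oriented toward L_i if i is even, and toward L_{i+1} if i is odd. -/

import Mathlib

theorem SimpleGraph.Connected.exists_adj_dist_eq_of_dist_eq_add_one {V : Type*}
    {G : SimpleGraph V} (hconn : G.Connected) {v0 u : V} {i : ℕ} (hu : G.dist v0 u = i + 1) :
    ∃ w, G.Adj u w ∧ G.dist v0 w = i := by
  obtain ⟨p, hp⟩ := hconn.exists_walk_length_eq_dist u v0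
  rw [SimpleGraph.dist_comm, hu] at hp
  cases p with
  | nil => simp at hp
  | @cons _ w _ h p =>
    rw [SimpleGraph.Walk.length_cons] at hp
    have hle := SimpleGraph.dist_le p
    rw [SimpleGraph.dist_comm] at hle
    have htri := hconn.dist_triangle (u := v0) (v := w) (w := u)
    rw [SimpleGraph.dist_eq_one_iff_adj.2 h.symm] at htri
    exact ⟨w, h, by omega⟩

/-- In a connected comparability graph with transitive orientation `E` having
sink `v0`, every edge between distance layers `L_i` and `L_{i+1}` from `v0`
is oriented toward `L_i` if `i` is even, and toward `L_{i+1}` if `i` is odd. -/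
theorem stmt_2 {V : Type*} (G : SimpleGraph V) (hconn : G.Connected)
    (E : V → V → Prop)
    (horient : ∀ u v, G.Adj u v ↔ (E u v ∨ E v u))
    (hasymm : ∀ u v, E u v → ¬ E v u)
    (htrans : ∀ u v w, E u v → E v w → E u w)
    (v0 : V) (hsink : ∀ u, ¬ E v0 u) :
    ∀ (i : ℕ) (u v : V), G.dist v0 u = i → G.dist v0 v = i + 1 → G.Adj u v →
      ((Even i → E v u) ∧ (Odd i → E u v)) := by
  intro i
  induction i with
  | zero =>
    intro u v hu _ huv
    obtain rfl := hconn.dist_eq_zero_iff.1 hu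
    exact ⟨fun _ => ((horient _ _).1 huv).resolve_left (hsink v), fun h => by simp at h⟩
  | succ i ih =>
    intro u v hu hv huv
    obtain ⟨w, huw, hw⟩ := hconn.exists_adj_dist_eq_of_dist_eq_add_one hu
    obtain ⟨heven, hodd⟩ := ih w u hw hu huw.symm
    have hwv : ¬ G.Adj w v := fun h => by
      have htri := hconn.dist_triangle (u := v0) (v := w) (w := v)
      rw [SimpleGraph.dist_eq_one_iff_adj.2 h] at htri
      omega
    rw [horient, not_or] at hwv
    have hor := (horient _ _).1 huv
    refine ⟨fun h => hor.resolve_left fun huv' => hwv.1 (htrans _ _ _ (hodd ?_) huv'),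
      fun h => hor.resolve_right fun hvu => hwv.2 (htrans _ _ _ hvu (heven ?_))⟩
    · rwa [Nat.even_add_one, Nat.not_even_iff_odd] at h
    · rwa [Nat.odd_add_one, Nat.not_odd_iff_even] at h
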